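/- arXiv:math/0002080 — 2 statements merged into one kernel-verified Lean document; each statement's English description precedes it below -/
import Mathlib

section
/- Let G be a discrete abelian group, T an aperiodic endomorphism of G (i.e. for every integer m ≥ 1 and g ∈ G, T^m g = g implies g = 0) with trivial kernel, and Y a finite subset of G with 0 ∈ Y. Then there exists n₀ ∈ ℕ such that whenever ∑_{l=1}^{k} T^{n(l-1)} y_l = 0 for some elements y_1, …, y_k ∈ Y, some n ≥ n₀ and some k ∈ ℕ, we have y_1 = … = y_k = 0. -/
open Polynomial

/-- A set `Y` is sparsely independent with respect to a scalar `x` if, for all large `n`, the only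
relations `∑ x ^ (n * l) • y l = 0` with coefficients in `Y` are the trivial ones. -/
def SparselyIndependent {R V : Type*} [Monoid R] [AddCommMonoid V] [DistribMulAction R V]
    (x : R) (Y : Set V) : Prop :=
  ∃ n₀ : ℕ, ∀ n ≥ n₀, ∀ k : ℕ, ∀ y : Fin k → V, (∀ l, y l ∈ Y) →
    ∑ l : Fin k, x ^ (n * (l : ℕ)) • y l = 0 → ∀ l, y l = 0

namespace SparselyIndependent

section Monoid

variable {R S V W : Type*} [Monoid R] [Monoid S] [AddCommMonoid V] [AddCommMonoid W]
  [DistribMulAction R V] [DistribMulAction S W] {x : R} {x' : S} {Y : Set V}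

theorem map_pow_smul {f : V →+ W} (hf : ∀ v, f (x • v) = x' • f v) (n : ℕ) (v : V) :
    f (x ^ n • v) = x' ^ n • f v := by
  induction n generalizing v with
  | zero => simp
  | succ n ih => rw [pow_succ, mul_smul, ih, hf, pow_succ, mul_smul]

theorem map_sum_eq_zero {f : V →+ W} (hf : ∀ v, f (x • v) = x' • f v) {n k : ℕ} {y : Fin k → V}
    (h : ∑ l : Fin k, x ^ (n * (l : ℕ)) • y l = 0) :
    ∑ l : Fin k, x' ^ (n * (l : ℕ)) • f (y l) = 0 := by
  simpa [map_sum, map_pow_smul hf] using congrArg f h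

theorem exists_map_eq_zero {f : V →+ W} (hf : ∀ v, f (x • v) = x' • f v)
    (h : SparselyIndependent x' (f '' Y)) :
    ∃ n₀ : ℕ, ∀ n ≥ n₀, ∀ k : ℕ, ∀ y : Fin k → V, (∀ l, y l ∈ Y) →
      ∑ l : Fin k, x ^ (n * (l : ℕ)) • y l = 0 → ∀ l, f (y l) = 0 := by
  obtain ⟨n₀, h⟩ := h
  exact ⟨n₀, fun n hn k y hy h0 ↦
    h n hn k (fun l ↦ f (y l)) (fun l ↦ ⟨y l, hy l, rfl⟩) (map_sum_eq_zero hf h0)⟩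

theorem of_image {f : V →+ W} (hf : ∀ v, f (x • v) = x' • f v) (hinj : Function.Injective f)
    (h : SparselyIndependent x' (f '' Y)) : SparselyIndependent x Y := by
  obtain ⟨n₀, h⟩ := exists_map_eq_zero hf h
  exact ⟨n₀, fun n hn k y hy h0 l ↦ (map_eq_zero_iff f hinj).1 (h n hn k y hy h0 l)⟩

theorem of_preimage {Z : Set W} {f : V →+ W} (hf : ∀ v, f (x • v) = x' • f v)
    (hinj : Function.Injective f) (hZ : Z ⊆ Set.range f)
    (h : SparselyIndependent x (f ⁻¹' Z)) : SparselyIndependent x' Z := by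
  obtain ⟨n₀, h⟩ := h
  refine ⟨n₀, fun n hn k z hz h0 l ↦ ?_⟩
  choose y hy using fun l ↦ hZ (hz l)
  have h1 : ∑ l : Fin k, x ^ (n * (l : ℕ)) • y l = 0 := by
    apply hinj
    simpa [map_sum, map_pow_smul hf, hy] using h0
  rw [← hy l, h n hn k y (fun l ↦ by simpa [hy l] using hz l) h1 l, map_zero]

theorem of_extension {f : V →+ W} (hf : ∀ v, f (x • v) = x' • f v)
    (h : SparselyIndependent x' (f '' Y))
    (hker : SparselyIndependent x (Y ∩ {v | f v = 0})) : SparselyIndependent x Y := by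
  obtain ⟨n₀, h⟩ := exists_map_eq_zero hf h
  obtain ⟨n₁, hker⟩ := hker
  refine ⟨max n₀ n₁, fun n hn k y hy h0 ↦ ?_⟩
  exact hker n (le_of_max_le_right hn) k y
    (fun l ↦ ⟨hy l, h n (le_of_max_le_left hn) k y hy h0 l⟩) h0

theorem of_separating (hY : Y.Finite)
    (h : ∀ v ∈ Y, v ≠ 0 → ∃ f : V →+ W, (∀ v, f (x • v) = x' • f v) ∧ f v ≠ 0 ∧
      SparselyIndependent x' (f '' Y)) : SparselyIndependent x Y := by
  have h' : ∀ v : V, ∃ n₀ : ℕ, v ∈ Y → v ≠ 0 → ∀ n ≥ n₀, ∀ k : ℕ, ∀ y : Fin k → V,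
      (∀ l, y l ∈ Y) → ∑ l : Fin k, x ^ (n * (l : ℕ)) • y l = 0 → ∀ l, y l ≠ v := by
    intro v
    by_cases hv : v ∈ Y ∧ v ≠ 0
    · obtain ⟨f, hf, hfv, hs⟩ := h v hv.1 hv.2
      obtain ⟨n₀, hs⟩ := exists_map_eq_zero hf hs
      refine ⟨n₀, fun _ _ n hn k y hy h0 l hl ↦ hfv ?_⟩
      rw [← hl, hs n hn k y hy h0 l]
    · exact ⟨0, fun h1 h2 ↦ absurd ⟨h1, h2⟩ hv⟩
  choose N hN using h'
  refine ⟨hY.toFinset.sup N, fun n hn k y hy h0 l ↦ ?_⟩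
  by_contra hne
  exact hN (y l) (hy l) hne n
    (le_trans (Finset.le_sup (f := N) (hY.mem_toFinset.2 (hy l))) hn) k y hy h0 l rfl

theorem sum_succ (n k : ℕ) (y : Fin (k + 1) → V) :
    ∑ l : Fin (k + 1), x ^ (n * (l : ℕ)) • y l =
      y 0 + x ^ n • ∑ l : Fin k, x ^ (n * (l : ℕ)) • y l.succ := by
  rw [Fin.sum_univ_succ, Finset.smul_sum]
  simp [← mul_smul, ← pow_add, mul_add, add_comm]

theorem of_head (hx : ∀ v : V, x • v = 0 → v = 0)
    (h : ∃ n₀ : ℕ, ∀ n ≥ n₀, ∀ k : ℕ, ∀ y : Fin k → V, (∀ l, y l ∈ Y) → ∀ v ∈ Y,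
      v + x ^ n • ∑ l : Fin k, x ^ (n * (l : ℕ)) • y l = 0 → v = 0) :
    SparselyIndependent x Y := by
  have hpow : ∀ (n : ℕ) (v : V), x ^ n • v = 0 → v = 0 := by
    intro n
    induction n with
    | zero => simp
    | succ n ih => exact fun v hv ↦ hx v (ih _ (by rwa [← mul_smul, ← pow_succ]))
  obtain ⟨n₀, h⟩ := h
  refine ⟨n₀, fun n hn k ↦ ?_⟩
  induction k with
  | zero => exact fun _ _ _ l ↦ l.elim0
  | succ k ih =>
    intro y hy h0
    rw [sum_succ] at h0
    have hy0 := h n hn k (fun l ↦ y l.succ) (fun l ↦ hy _) (y 0) (hy 0) h0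
    rw [hy0, zero_add] at h0
    exact Fin.cases hy0 (ih (fun l ↦ y l.succ) (fun l ↦ hy _) (hpow n _ h0))

end Monoid

section Field

variable {K : Type*} [Field K]

theorem of_inv {x : K} (hx : x ≠ 0) {Y : Set K} (h : SparselyIndependent x⁻¹ Y) :
    SparselyIndependent x Y := by
  obtain ⟨n₀, h⟩ := h
  refine ⟨n₀, fun n hn k y hy h0 l ↦ ?_⟩
  have h1 : ∑ l : Fin k, x⁻¹ ^ (n * (l : ℕ)) • y l.rev = 0 := by
    rw [← Equiv.sum_comp Fin.revPerm]
    have h2 := congrArg (x⁻¹ ^ (n * (k - 1)) • ·) h0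
    simp only [smul_zero, Finset.smul_sum] at h2
    rw [← h2]
    refine Finset.sum_congr rfl fun i _ ↦ ?_
    have hi := i.isLt
    have h3 : n * (k - 1) = n * ((i.rev : Fin k) : ℕ) + n * (i : ℕ) := by
      rw [← mul_add, Fin.val_rev]
      congr 1
      omega
    simp only [Fin.revPerm_apply, Fin.rev_rev, smul_eq_mul]
    rw [h3, pow_add, inv_pow x (n * (i : ℕ))]
    field_simp
  simpa using h n hn k (fun l ↦ y l.rev) (fun l ↦ hy _) h1 l.rev

theorem of_abv_lt_one (a : AbsoluteValue K ℝ) {x : K} (hx : x ≠ 0) (hax : a x < 1) {Y : Set K}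
    (hY : Y.Finite) : SparselyIndependent x Y := by
  apply of_head (fun v hv ↦ (smul_eq_zero.1 hv).resolve_left hx)
  obtain ⟨C, hC⟩ : ∃ C : ℝ, ∀ y ∈ Y, a y ≤ C := by
    obtain ⟨C, hC⟩ := (hY.image a).bddAbove
    exact ⟨C, fun y hy ↦ hC ⟨y, hy, rfl⟩⟩
  have hpos : 0 < 1 - a x := by linarith
  have hev : ∀ v ∈ Y, ∀ᶠ n : ℕ in Filter.atTop, v ≠ 0 → a x ^ n * (C / (1 - a x)) < a v := by
    intro v _
    by_cases hv : v = 0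
    · simp [hv]
    · have ht : Filter.Tendsto (fun n : ℕ ↦ a x ^ n * (C / (1 - a x))) Filter.atTop (nhds 0) := by
        simpa using (tendsto_pow_atTop_nhds_zero_of_lt_one (a.nonneg x) hax).mul_const
          (C / (1 - a x))
      filter_upwards [ht.eventually_lt_const (a.pos hv)] with n hn _ using hn
  obtain ⟨n₀, hn₀⟩ := Filter.eventually_atTop.1
    (((Filter.eventually_all_finite hY).2 hev).and (Filter.eventually_ge_atTop 1))
  refine ⟨n₀, fun n hn k y hy v hv h0 ↦ ?_⟩
  obtain ⟨hlt, hn1⟩ := hn₀ n hn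
  have hC0 : 0 ≤ C := (a.nonneg v).trans (hC v hv)
  have hq : a x ^ n ≤ a x := by
    simpa using pow_le_pow_of_le_one (a.nonneg x) hax.le hn1
  have hbound : ∀ (k : ℕ) (y : Fin k → K), (∀ l, y l ∈ Y) →
      a (∑ l : Fin k, x ^ (n * (l : ℕ)) • y l) ≤ C / (1 - a x) := by
    intro k
    induction k with
    | zero => intro y _; simp; positivity
    | succ k ih =>
      intro y hy
      rw [sum_succ]
      calc _ ≤ a (y 0) + a (x ^ n • ∑ l : Fin k, x ^ (n * (l : ℕ)) • y l.succ) := a.add_le _ _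
        _ ≤ C + a x * (C / (1 - a x)) := by
          rw [smul_eq_mul, map_mul, map_pow]
          exact add_le_add (hC _ (hy 0))
            (mul_le_mul hq (ih _ fun l ↦ hy _) (a.nonneg _) (a.nonneg _))
        _ = C / (1 - a x) := by field_simp; ring
  by_contra hne
  have h1 := hlt v hv hne
  have h2 : a v = a x ^ n * a (∑ l : Fin k, x ^ (n * (l : ℕ)) • y l) := by
    rw [eq_neg_of_add_eq_zero_left h0, a.map_neg, smul_eq_mul, map_mul, map_pow]
  have h3 := mul_le_mul_of_nonneg_left (hbound k y hy) (pow_nonneg (a.nonneg x) n)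
  linarith

theorem of_abv_ne_one (a : AbsoluteValue K ℝ) {x : K} (hx : x ≠ 0) (hax : a x ≠ 1) {Y : Set K}
    (hY : Y.Finite) : SparselyIndependent x Y := by
  rcases lt_or_gt_of_ne hax with h | h
  · exact of_abv_lt_one a hx h hY
  · refine of_inv hx (of_abv_lt_one a (inv_ne_zero hx) ?_ hY)
    rw [map_inv₀]
    exact inv_lt_one_of_one_lt₀ h

theorem polynomial_X {Y : Set K[X]} (hY : Y.Finite) : SparselyIndependent (X : K[X]) Y := by
  apply of_head (fun v hv ↦ (smul_eq_zero.1 hv).resolve_left X_ne_zero)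
  refine ⟨hY.toFinset.sup natDegree + 1, fun n hn k y _ v hv h0 ↦ ?_⟩
  have hdeg : v.natDegree < n :=
    lt_of_lt_of_le (Nat.lt_succ_of_le (Finset.le_sup (f := natDegree) (hY.mem_toFinset.2 hv))) hn
  have hdvd : (X : K[X]) ^ n ∣ v := by
    rw [eq_neg_of_add_eq_zero_left h0]
    exact (Dvd.intro _ rfl).neg_right
  by_contra hne
  have := natDegree_le_of_dvd hdvd hne
  rw [natDegree_X_pow] at this
  omega

end Field

end SparselyIndependent

theorem NumberField.exists_absoluteValue_ne_one {L : Type*} [Field L] [NumberField L] {x : L}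
    (hx : x ≠ 0) (hroot : ∀ m : ℕ, 1 ≤ m → x ^ m ≠ 1) : ∃ a : AbsoluteValue L ℝ, a x ≠ 1 := by
  by_contra! hall
  have hint : IsIntegral ℤ x := by
    obtain ⟨z, rfl⟩ := IsDedekindDomain.HeightOneSpectrum.mem_integers_of_valuation_le_one
      (R := NumberField.RingOfIntegers L) L x fun v ↦ by
        by_contra! hv
        have h := hall (NumberField.HeightOneSpectrum.adicAbv L v)
        rw [NumberField.HeightOneSpectrum.adicAbv_def] at h
        have h1 := WithZeroMulInt.toNNReal_strictMono
          (NumberField.HeightOneSpectrum.one_lt_absNorm_nnreal v) hv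
        rw [map_one] at h1
        exact h1.ne' (by exact_mod_cast h)
    exact z.isIntegral_coe
  obtain ⟨n, hn, h⟩ := NumberField.Embeddings.pow_eq_one_of_norm_eq_one L ℂ hint
    fun φ ↦ hall (NumberField.place φ)
  exact hroot n hn h

namespace SparselyIndependent

theorem of_transcendental (F : Type*) {K : Type*} [Field F] [Field K] [Algebra F K] {x : K}
    (hx : Transcendental F x) {Y : Set K} (hY : Y.Finite)
    (hYx : Y ⊆ Set.range (aeval x : ℤ[X] →ₐ[ℤ] K)) : SparselyIndependent x Y := by
  have hinj : Function.Injective (aeval x : F[X] →ₐ[F] K) :=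
    transcendental_iff_injective.1 hx
  refine of_preimage (f := ((aeval x : F[X] →ₐ[F] K) : F[X] →+ K)) (x := (X : F[X])) (by simp)
    hinj (hYx.trans ?_) (polynomial_X (hY.preimage hinj.injOn))
  rintro _ ⟨p, rfl⟩
  refine ⟨p.map (Int.castRingHom F), ?_⟩
  simp only [AddMonoidHom.coe_coe, aeval_def, eval₂_map]
  congr 1
  exact RingHom.ext_int _ _

theorem of_field {K : Type*} [Field K] {x : K} (hx : x ≠ 0)
    (hroot : ∀ m : ℕ, 1 ≤ m → x ^ m ≠ 1) {Y : Set K} (hY : Y.Finite)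
    (hYx : Y ⊆ Set.range (aeval x : ℤ[X] →ₐ[ℤ] K)) : SparselyIndependent x Y := by
  obtain ⟨p, hp⟩ := CharP.exists K
  rcases CharP.char_is_prime_or_zero K p with hpp | rfl
  · have := Fact.mk hpp
    let := ZMod.algebra K p
    refine of_transcendental (ZMod p) (fun halg ↦ ?_) hY hYx
    have := IntermediateField.adjoin.finiteDimensional halg.isIntegral
    have : Finite (IntermediateField.adjoin (ZMod p) {x}) := Module.finite_of_finite (ZMod p)
    obtain ⟨n, hn, h⟩ := isOfFinOrder_iff_pow_eq_one.1 (isOfFinOrder_of_finite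
      (Units.mk0 (IntermediateField.AdjoinSimple.gen (ZMod p) x) fun h ↦
        hx (by simpa using congrArg Subtype.val h)))
    exact hroot n hn (by simpa using congrArg Subtype.val (congrArg Units.val h))
  · have := CharP.charP_to_charZero K
    by_cases halg : IsAlgebraic ℚ x
    · have := IntermediateField.adjoin.finiteDimensional halg.isIntegral
      have : NumberField (IntermediateField.adjoin ℚ {x}) := { }
      set g := IntermediateField.AdjoinSimple.gen ℚ x
      have hgx : (g : K) = x := IntermediateField.AdjoinSimple.coe_gen ℚ x
      have hg0 : g ≠ 0 := fun h ↦ hx (by rw [← hgx, h]; rfl)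
      obtain ⟨a, ha⟩ := NumberField.exists_absoluteValue_ne_one hg0 fun m hm h ↦
        hroot m hm (by rw [← hgx]; exact_mod_cast congrArg Subtype.val h)
      refine of_preimage
        (f := ((IntermediateField.adjoin ℚ {x}).val : IntermediateField.adjoin ℚ {x} →+ K))
        (x := g) (by simp [hgx]) Subtype.val_injective (hYx.trans ?_)
        (of_abv_ne_one a hg0 ha (hY.preimage Subtype.val_injective.injOn))
      rintro _ ⟨q, rfl⟩
      refine ⟨aeval g q, ?_⟩
      have h := aeval_algHom_apply ((IntermediateField.adjoin ℚ {x}).val.restrictScalars ℤ) g q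
      rw [AlgHom.restrictScalars_apply, IntermediateField.coe_val, hgx] at h
      exact h.symm
    · exact of_transcendental ℚ halg hY hYx

theorem of_fractionRing {D : Type*} [CommRing D] [IsDomain D] {x : D} (hx : x ≠ 0)
    (hroot : ∀ m : ℕ, 1 ≤ m → x ^ m ≠ 1)
    (hgen : Function.Surjective (aeval x : ℤ[X] →ₐ[ℤ] D)) {Y : Set (FractionRing D)}
    (hY : Y.Finite) : SparselyIndependent (algebraMap D (FractionRing D) x) Y := by
  have hinj := IsFractionRing.injective D (FractionRing D)
  obtain ⟨d, hd⟩ := IsLocalization.exist_integer_multiples_of_finset (nonZeroDivisors D)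
    hY.toFinset
  have hd0 : algebraMap D (FractionRing D) d ≠ 0 :=
    (map_ne_zero_iff _ hinj).2 (nonZeroDivisors.coe_ne_zero d)
  refine of_image (f := AddMonoidHom.mulLeft (algebraMap D (FractionRing D) d))
    (x' := algebraMap D (FractionRing D) x) (fun v ↦ by simp [mul_left_comm])
    (mul_right_injective₀ hd0) (of_field ((map_ne_zero_iff _ hinj).2 hx) (fun m hm h ↦ ?_)
      (hY.image _) ?_)
  · rw [← map_pow, ← map_one (algebraMap D (FractionRing D))] at h
    exact hroot m hm (hinj h)
  · rintro _ ⟨v, hv, rfl⟩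
    obtain ⟨e, he⟩ := hd v (hY.mem_toFinset.2 hv)
    obtain ⟨q, rfl⟩ := hgen e
    refine ⟨q, ?_⟩
    rw [Algebra.smul_def] at he
    rw [AddMonoidHom.coe_mulLeft, ← he, aeval_algebraMap_apply]

theorem of_torsionFree {D V : Type*} [CommRing D] [IsDomain D] [AddCommGroup V] [Module D V]
    (htf : ∀ (d : D) (v : V), d • v = 0 → d = 0 ∨ v = 0) {x : D} (hx : x ≠ 0)
    (hroot : ∀ m : ℕ, 1 ≤ m → x ^ m ≠ 1)
    (hgen : Function.Surjective (aeval x : ℤ[X] →ₐ[ℤ] D)) {Y : Set V}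
    (hY : Y.Finite) : SparselyIndependent x Y := by
  let ι := LocalizedModule.mkLinearMap (nonZeroDivisors D) V
  refine of_separating (W := FractionRing D) (x' := algebraMap D (FractionRing D) x) hY
    fun v _ hv ↦ ?_
  have hιv : ι v ≠ 0 := fun h ↦ by
    obtain ⟨s, hs⟩ := (IsLocalizedModule.eq_zero_iff (nonZeroDivisors D) ι).1 h
    exact (htf s v hs).elim (nonZeroDivisors.coe_ne_zero s) hv
  let : Module (FractionRing D) (LocalizedModule (nonZeroDivisors D) V) :=
    inferInstanceAs (Module (Localization (nonZeroDivisors D)) _)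
  have : IsScalarTower D (FractionRing D) (LocalizedModule (nonZeroDivisors D) V) :=
    inferInstanceAs (IsScalarTower D (Localization (nonZeroDivisors D)) _)
  obtain ⟨φ, hφ⟩ := not_forall.1
    (mt (Module.forall_dual_apply_eq_zero_iff (FractionRing D) (ι v)).1 hιv)
  refine ⟨(φ : LocalizedModule (nonZeroDivisors D) V →+ FractionRing D).comp ι, fun w ↦ ?_, hφ,
    of_fractionRing hx hroot hgen (hY.image _)⟩
  simp only [AddMonoidHom.comp_apply, AddMonoidHom.coe_coe, map_smul]
  rw [← algebraMap_smul (FractionRing D) x (ι w)]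
  exact map_smul φ _ _

end SparselyIndependent

/-- Some nonzero element has an annihilator that is prime and maximal among the annihilators of
nonzero elements. -/
theorem exists_maximal_torsionOf {R V : Type*} [CommRing R] [IsNoetherianRing R]
    [AddCommGroup V] [Module R V] [Nontrivial V] :
    ∃ v : V, v ≠ 0 ∧ (Ideal.torsionOf R V v).IsPrime ∧
      ∀ w : V, w ≠ 0 → Ideal.torsionOf R V v ≤ Ideal.torsionOf R V w →
        Ideal.torsionOf R V w = Ideal.torsionOf R V v := by
  obtain ⟨v₀, hv₀⟩ := exists_ne (0 : V)
  obtain ⟨P, ⟨v, hv, rfl⟩, hmax⟩ := set_has_maximal_iff_noetherian.2 ‹IsNoetherianRing R›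
    {I | ∃ v : V, v ≠ 0 ∧ Ideal.torsionOf R V v = I} ⟨_, v₀, hv₀, rfl⟩
  have hmax' : ∀ w : V, w ≠ 0 → Ideal.torsionOf R V v ≤ Ideal.torsionOf R V w →
      Ideal.torsionOf R V w = Ideal.torsionOf R V v := fun w hw hle ↦
    (hle.eq_of_not_lt (hmax _ ⟨w, hw, rfl⟩)).symm
  refine ⟨v, hv, ⟨?_, ?_⟩, hmax'⟩
  · rw [Ne, Ideal.eq_top_iff_one, Ideal.mem_torsionOf_iff, one_smul]
    exact hv
  · intro r s hrs
    by_cases hs : s • v = 0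
    · exact Or.inr ((Ideal.mem_torsionOf_iff _ _).2 hs)
    · left
      rw [← hmax' (s • v) hs fun t ht ↦ by
        rw [Ideal.mem_torsionOf_iff] at ht ⊢
        rw [smul_comm, ht, smul_zero]]
      rw [Ideal.mem_torsionOf_iff] at hrs ⊢
      rwa [← mul_smul]

namespace SparselyIndependent

theorem of_torsionBySet {V : Type*} [AddCommGroup V] [Module ℤ[X] V] (P : Ideal ℤ[X]) [P.IsPrime]
    (hP : ∀ w : V, w ≠ 0 → P ≤ Ideal.torsionOf ℤ[X] V w → Ideal.torsionOf ℤ[X] V w = P)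
    (hX : X ∉ P) (hroot : ∀ m : ℕ, 1 ≤ m → X ^ m - 1 ∉ P)
    {Y : Set (Submodule.torsionBySet ℤ[X] V (P : Set ℤ[X]))} (hY : Y.Finite) :
    SparselyIndependent (X : ℤ[X]) Y := by
  have hgen : Function.Surjective
      (aeval (Ideal.Quotient.mk P X) : ℤ[X] →ₐ[ℤ] ℤ[X] ⧸ P) := by
    intro d
    obtain ⟨q, rfl⟩ := Ideal.Quotient.mk_surjective d
    refine ⟨q, ?_⟩
    have h := aeval_algHom_apply (Ideal.Quotient.mkₐ ℤ P) X q
    rw [aeval_X_left_apply] at h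
    exact h
  refine of_image (f := AddMonoidHom.id _) (x' := Ideal.Quotient.mk P X) (fun v ↦ rfl)
    Function.injective_id (of_torsionFree ?_ ?_ ?_ hgen (hY.image _))
  · intro d v hdv
    obtain ⟨r, rfl⟩ := Ideal.Quotient.mk_surjective d
    refine or_iff_not_imp_right.2 fun hv ↦ Ideal.Quotient.eq_zero_iff_mem.2 ?_
    rw [← hP v (by simpa using hv) fun s hs ↦ (Ideal.mem_torsionOf_iff _ _).2
      ((Submodule.mem_torsionBySet_iff _ _).1 v.2 ⟨s, hs⟩), Ideal.mem_torsionOf_iff]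
    exact congrArg Subtype.val hdv
  · exact fun h ↦ hX (Ideal.Quotient.eq_zero_iff_mem.1 h)
  · intro m hm h
    rw [← map_pow, ← map_one (Ideal.Quotient.mk P), Ideal.Quotient.eq] at h
    exact hroot m hm h

theorem of_quotient {M : Type*} [AddCommGroup M] [Module ℤ[X] M] [IsNoetherian ℤ[X] M]
    (N : Submodule ℤ[X] M) (hX : ∀ v : M ⧸ N, (X : ℤ[X]) • v = 0 → v = 0)
    (hroot : ∀ m : ℕ, 1 ≤ m → ∀ v : M ⧸ N, (X ^ m - 1 : ℤ[X]) • v = 0 → v = 0)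
    {Y : Set (M ⧸ N)} (hY : Y.Finite) : SparselyIndependent (X : ℤ[X]) Y := by
  induction N using IsNoetherian.induction with
  | hgt N ih =>
    rcases subsingleton_or_nontrivial (M ⧸ N) with hs | hs
    · exact ⟨0, fun _ _ _ _ _ _ _ ↦ Subsingleton.elim _ _⟩
    obtain ⟨v, hv, hprime, hmax⟩ := exists_maximal_torsionOf (R := ℤ[X]) (V := M ⧸ N)
    set P := Ideal.torsionOf ℤ[X] (M ⧸ N) v
    set T := Submodule.torsionBySet ℤ[X] (M ⧸ N) (P : Set ℤ[X]) with hT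
    have hmemT : ∀ w : M ⧸ N, w ∈ T ↔ ∀ r ∈ P, r • w = 0 := fun w ↦ by
      rw [hT, Submodule.mem_torsionBySet_iff]
      exact Subtype.forall
    have hle : N ≤ T.comap N.mkQ := fun m hm ↦ by
      rw [Submodule.mem_comap, Submodule.mkQ_apply, (Submodule.Quotient.mk_eq_zero N).2 hm]
      exact T.zero_mem
    have hlt : N < T.comap N.mkQ := by
      refine lt_of_le_of_ne hle fun heq ↦ hv ?_
      obtain ⟨m, rfl⟩ := N.mkQ_surjective v
      rw [Submodule.mkQ_apply, Submodule.Quotient.mk_eq_zero, heq, Submodule.mem_comap, hmemT]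
      exact fun r hr ↦ (Ideal.mem_torsionOf_iff _ _).1 hr
    have hinj : ∀ r : ℤ[X], (∀ w : M ⧸ N, r • w = 0 → w = 0) →
        ∀ w : M ⧸ T.comap N.mkQ, r • w = 0 → w = 0 := by
      intro r hr w hw
      obtain ⟨m, rfl⟩ := Submodule.mkQ_surjective _ w
      rw [← map_smul, Submodule.mkQ_apply, Submodule.Quotient.mk_eq_zero, Submodule.mem_comap,
        map_smul, hmemT] at hw
      rw [Submodule.mkQ_apply, Submodule.Quotient.mk_eq_zero, Submodule.mem_comap, hmemT]
      exact fun s hs ↦ hr _ (by rw [smul_comm, hw s hs])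
    refine of_extension (f := (Submodule.factor hle : M ⧸ N →+ M ⧸ T.comap N.mkQ))
      (x' := (X : ℤ[X])) (fun w ↦ map_smul (Submodule.factor hle) X w)
      (ih _ hlt (hinj _ hX) (fun m hm ↦ hinj _ (hroot m hm)) (hY.image _)) ?_
    have hsub : Function.Injective (T.subtype : T →+ M ⧸ N) := Subtype.val_injective
    refine of_preimage (f := (T.subtype : T →+ M ⧸ N)) (x := (X : ℤ[X])) (fun w ↦ rfl) hsub ?_
      (of_torsionBySet P hmax (fun h ↦ hv (hX v ((Ideal.mem_torsionOf_iff _ _).1 h)))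
        (fun m hm h ↦ hv (hroot m hm v ((Ideal.mem_torsionOf_iff _ _).1 h)))
        ((hY.inter_of_left _).preimage hsub.injOn))
    rintro w ⟨-, hw⟩
    obtain ⟨m, rfl⟩ := N.mkQ_surjective w
    have hw' : m ∈ T.comap N.mkQ := (Submodule.Quotient.mk_eq_zero _).1 hw
    exact ⟨⟨N.mkQ m, hw'⟩, rfl⟩

theorem of_finite {V : Type*} [AddCommGroup V] [Module ℤ[X] V]
    (hX : ∀ v : V, (X : ℤ[X]) • v = 0 → v = 0)
    (hroot : ∀ m : ℕ, 1 ≤ m → ∀ v : V, (X ^ m - 1 : ℤ[X]) • v = 0 → v = 0)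
    {Y : Set V} (hY : Y.Finite) : SparselyIndependent (X : ℤ[X]) Y := by
  have := isNoetherian_span_of_finite ℤ[X] hY
  set M := Submodule.span ℤ[X] Y
  let e := Submodule.quotEquivOfEqBot (⊥ : Submodule ℤ[X] M) rfl
  have hinj : Function.Injective (M.subtype ∘ₗ e.toLinearMap) :=
    Subtype.val_injective.comp e.injective
  have htransfer : ∀ r : ℤ[X], (∀ w : V, r • w = 0 → w = 0) →
      ∀ w : M ⧸ (⊥ : Submodule ℤ[X] M), r • w = 0 → w = 0 := fun r hr w hw ↦
    (map_eq_zero_iff _ hinj).1 (hr _ (by rw [← map_smul, hw, map_zero]))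
  refine of_preimage (f := (M.subtype ∘ₗ e.toLinearMap).toAddMonoidHom) (x := (X : ℤ[X]))
    (fun w ↦ map_smul (M.subtype ∘ₗ e.toLinearMap) X w) hinj
    (fun y hy ↦ ⟨e.symm ⟨y, Submodule.subset_span hy⟩, ?_⟩)
    (of_quotient ⊥ (htransfer _ hX) (fun m hm ↦ htransfer _ (hroot m hm))
      (hY.preimage hinj.injOn))
  simp

end SparselyIndependent

/-- Let `G` be a discrete abelian group, `T` an aperiodic endomorphism of `G`
(for every `m ≥ 1` and `g`, `T^m g = g` implies `g = 0`) with trivial kernel, and `Y` a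
finite subset of `G` with `0 ∈ Y`. Then there exists `n₀ ∈ ℕ` such that whenever
`∑_{l=1}^{k} T^{n(l-1)} y_l = 0` for `y_1, …, y_k ∈ Y`, `n ≥ n₀` and `k ∈ ℕ`, we have
`y_1 = … = y_k = 0`. -/
theorem statement0 {G : Type*} [AddCommGroup G] (T : AddMonoid.End G)
    (hinj : Function.Injective T)
    (haper : ∀ m : ℕ, 1 ≤ m → ∀ g : G, (T ^ m) g = g → g = 0)
    (Y : Finset G) (hY : (0 : G) ∈ Y) :
    ∃ n₀ : ℕ, ∀ n ≥ n₀, ∀ k : ℕ, ∀ y : Fin k → G, (∀ l, y l ∈ Y) →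
      (∑ l : Fin k, (T ^ (n * (l : ℕ))) (y l)) = 0 → ∀ l, y l = 0 := by
  let : Module ℤ[X] G := Module.compHom G (aeval T : ℤ[X] →ₐ[ℤ] AddMonoid.End G).toRingHom
  have hsmul : ∀ (p : ℤ[X]) (g : G), p • g = (aeval T p : AddMonoid.End G) g := fun _ _ ↦ rfl
  obtain ⟨n₀, h⟩ := SparselyIndependent.of_finite (V := G)
    (fun v hv ↦ hinj (by rw [map_zero]; simpa [hsmul] using hv))
    (fun m hm v hv ↦ haper m hm v (by
      rw [sub_smul, one_smul, sub_eq_zero, hsmul, map_pow, aeval_X] at hv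
      exact hv)) Y.finite_toSet
  refine ⟨n₀, fun n hn k y hy h0 ↦ h n hn k y hy ?_⟩
  rw [← h0]
  refine Finset.sum_congr rfl fun l _ ↦ ?_
  rw [hsmul, map_pow, aeval_X]
end

section
/- Let d ≥ 1 and let T : ℤ^d → ℤ^d be an injective group endomorphism (given by an integer matrix with nonzero determinant) which is aperiodic, i.e. for every integer m ≥ 1 and y ∈ ℤ^d, T^m y = y implies y = 0. Let Y be a finite subset of ℤ^d with 0 ∈ Y. Then there exists n₀ ∈ ℕ such that whenever ∑_{l=1}^{k} T^{n(l-1)} y_l = 0 for some y_1, …, y_k ∈ Y, some n ≥ n₀ and some k ∈ ℕ, we have y_1 = … = y_k = 0. -/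
open Polynomial in
/-- A nonsingular integer matrix none of whose powers has eigenvalue `1` has a complex eigenvalue
outside the closed unit disc, by Kronecker's theorem. -/
theorem Matrix.exists_vecMul_eq_smul_of_one_lt_norm {ι : Type*} [Fintype ι] [DecidableEq ι]
    [Nonempty ι] (A : Matrix ι ι ℤ) (hA : A.det ≠ 0)
    (hper : ∀ m : ℕ, 1 ≤ m → (A ^ m - 1).det ≠ 0) :
    ∃ z : ℂ, 1 < ‖z‖ ∧ ∃ v : ι → ℂ, v ≠ 0 ∧
      Matrix.vecMul v (A.map (Int.castRingHom ℂ)) = z • v := by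
  set B : Matrix ι ι ℂ := A.map (Int.castRingHom ℂ) with hB
  have hBmap : (Int.castRingHom ℂ).mapMatrix A = B := rfl
  have hpoly : A.charpoly.map (Int.castRingHom ℂ) = B.charpoly :=
    (Matrix.charpoly_map A (Int.castRingHom ℂ)).symm
  have eigenvector : ∀ z : ℂ, B.charpoly.IsRoot z →
      ∃ v : ι → ℂ, v ≠ 0 ∧ Matrix.vecMul v B = z • v := by
    intro z hz
    rw [IsRoot.def, Matrix.eval_charpoly] at hz
    obtain ⟨v, hv, h⟩ := Matrix.exists_vecMul_eq_zero_iff.2 hz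
    refine ⟨v, hv, ?_⟩
    rw [Matrix.vecMul_sub, sub_eq_zero] at h
    rw [← h]
    ext i
    simp [Matrix.vecMul_diagonal, mul_comm]
  by_contra! hcon
  have hle : ∀ z : ℂ, B.charpoly.IsRoot z → ‖z‖ ≤ 1 := by
    intro z hz
    by_contra! h
    obtain ⟨v, hv, hvB⟩ := eigenvector z hz
    exact hcon z h v hv hvB
  have hmahler : (A.charpoly.map (Int.castRingHom ℂ)).mahlerMeasure = 1 := by
    rw [hpoly, mahlerMeasure_eq_leadingCoeff_mul_prod_roots,
      (Matrix.charpoly_monic B).leadingCoeff, norm_one, one_mul]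
    refine Multiset.prod_eq_one fun x hx => ?_
    obtain ⟨z, hz, rfl⟩ := Multiset.mem_map.1 hx
    exact max_eq_left (hle z (isRoot_of_mem_roots hz))
  obtain ⟨z, hz⟩ : ∃ z, B.charpoly.IsRoot z := by
    refine IsAlgClosed.exists_root _ ?_
    rw [Matrix.charpoly_degree_eq_dim]
    exact_mod_cast Fintype.card_ne_zero
  have hz0 : z ≠ 0 := by
    rintro rfl
    rw [IsRoot.def, Matrix.eval_charpoly, map_zero, zero_sub, Matrix.det_neg, ← hBmap,
      ← RingHom.map_det] at hz
    simp [hA] at hz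
  have hzroot : z ∈ A.charpoly.aroots ℂ := by
    rw [mem_aroots]
    refine ⟨(Matrix.charpoly_monic A).ne_zero, ?_⟩
    rw [← hpoly, IsRoot.def, eval_map] at hz
    exact hz
  obtain ⟨n, hn, hzn⟩ := pow_eq_one_of_mahlerMeasure_eq_one hmahler hz0 hzroot
  obtain ⟨v, hv, hvB⟩ := eigenvector z hz
  have hpow : ∀ k : ℕ, Matrix.vecMul v (B ^ k) = z ^ k • v := by
    intro k
    induction k with
    | zero => simp
    | succ k ih =>
      rw [pow_succ, ← Matrix.vecMul_vecMul, ih, Matrix.smul_vecMul, hvB, smul_smul, pow_succ]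
  have hdet : (B ^ n - 1).det = 0 := by
    refine Matrix.exists_vecMul_eq_zero_iff.1 ⟨v, hv, ?_⟩
    rw [Matrix.vecMul_sub, hpow, hzn]
    simp
  refine hper n hn ?_
  rw [← hBmap, ← map_pow, ← map_one (Int.castRingHom ℂ).mapMatrix, ← map_sub,
    ← RingHom.map_det] at hdet
  simpa using hdet

theorem LinearMap.exists_eigenfunctional_of_aperiodic {M : Type*} [AddCommGroup M]
    [Module.Free ℤ M] [Module.Finite ℤ M] [Nontrivial M] (f : M →ₗ[ℤ] M)
    (hinj : Function.Injective f)
    (haper : ∀ m : ℕ, 1 ≤ m → ∀ y : M, (f ^ m) y = y → y = 0) :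
    ∃ z : ℂ, 1 < ‖z‖ ∧ ∃ φ : M →ₗ[ℤ] ℂ, φ ≠ 0 ∧ ∀ x, φ (f x) = z * φ x := by
  classical
  let b := Module.Free.chooseBasis ℤ M
  have : Nonempty (Module.Free.ChooseBasisIndex ℤ M) := b.index_nonempty
  have det_ne : ∀ g : M →ₗ[ℤ] M, (∀ y, g y = 0 → y = 0) → (LinearMap.toMatrix b b g).det ≠ 0 := by
    intro g hg h
    rw [LinearMap.det_toMatrix] at h
    obtain ⟨y, hy, hy0⟩ := (Submodule.ne_bot_iff _).1 (LinearMap.bot_lt_ker_of_det_eq_zero h).ne'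
    exact hy0 (hg y hy)
  obtain ⟨z, hz, v, hv, hvz⟩ := Matrix.exists_vecMul_eq_smul_of_one_lt_norm
    (LinearMap.toMatrix b b f) (det_ne f fun y hy => hinj (by simpa using hy))
    (fun m hm => by
      have := det_ne (f ^ m - 1) fun y hy => haper m hm y (by simpa [sub_eq_zero] using hy)
      rwa [map_sub, ← LinearMap.toMatrix_pow, LinearMap.toMatrix_one] at this)
  refine ⟨z, hz, b.constr ℤ v, ?_, fun x => ?_⟩
  · intro h
    exact hv (funext fun i => by simpa using LinearMap.congr_fun h (b i))
  · have : (b.constr ℤ v).comp f = (LinearMap.mulLeft ℤ z).comp (b.constr ℤ v) := by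
      refine b.ext fun j => ?_
      have hj := congrFun hvz j
      rw [LinearMap.comp_apply, ← b.sum_repr (f (b j))]
      simp only [map_sum, map_smul, Module.Basis.constr_basis, LinearMap.comp_apply,
        LinearMap.mulLeft_apply]
      simp only [Matrix.vecMul, dotProduct, Matrix.map_apply, LinearMap.toMatrix_apply,
        Pi.smul_apply, smul_eq_mul, eq_intCast] at hj
      rw [← hj]
      exact Finset.sum_congr rfl fun i _ => by rw [zsmul_eq_mul, mul_comm]
    exact LinearMap.congr_fun this x

theorem eq_zero_of_sum_pow_mul_eq_zero {μ : ℂ} {δ C : ℝ} (hδ : 0 < δ) (hC : 0 ≤ C)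
    (hμ : 1 + C / δ < ‖μ‖) (k : ℕ) (c : Fin k → ℂ) (hcC : ∀ l, ‖c l‖ ≤ C)
    (hcδ : ∀ l, c l ≠ 0 → δ ≤ ‖c l‖) (hsum : ∑ l : Fin k, μ ^ (l : ℕ) * c l = 0) :
    ∀ l, c l = 0 := by
  induction k with
  | zero => exact fun l => l.elim0
  | succ k ih =>
    simp only [Fin.sum_univ_castSucc, Fin.val_castSucc, Fin.val_last] at hsum
    have hlast : c (Fin.last k) = 0 := by
      by_contra hne
      have hgt : 0 < ‖μ‖ - 1 := by linarith [div_nonneg hC hδ.le]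
      have hCδ : C < δ * (‖μ‖ - 1) := by
        rw [← div_lt_iff₀' hδ]
        linarith
      have hbound : ‖μ‖ ^ k * δ ≤ C * ∑ i ∈ Finset.range k, ‖μ‖ ^ i := by
        calc ‖μ‖ ^ k * δ ≤ ‖μ‖ ^ k * ‖c (Fin.last k)‖ := by gcongr; exact hcδ _ hne
          _ = ‖∑ l : Fin k, μ ^ (l : ℕ) * c l.castSucc‖ := by
              rw [eq_neg_of_add_eq_zero_left hsum]
              simp
          _ ≤ ∑ l : Fin k, ‖μ‖ ^ (l : ℕ) * C := by
              refine norm_sum_le_of_le _ fun l _ => ?_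
              rw [norm_mul, norm_pow]
              gcongr
              exact hcC _
          _ = C * ∑ i ∈ Finset.range k, ‖μ‖ ^ i := by
              rw [← Finset.sum_mul, mul_comm, Finset.sum_range]
      have hgeom := geom_sum_mul ‖μ‖ k
      have hpow : 0 < ‖μ‖ ^ k := pow_pos (by linarith) k
      have h₁ : ‖μ‖ ^ k * (δ * (‖μ‖ - 1)) ≤ C * (‖μ‖ ^ k - 1) := by
        rw [← hgeom]
        nlinarith
      nlinarith
    have hinit := ih (fun l => c l.castSucc) (fun l => hcC _) (fun l => hcδ _)
      (by simpa [hlast] using hsum)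
    exact Fin.lastCases hlast hinit

theorem exists_forall_eq_zero_of_sum_pow_mul_eq_zero {z : ℂ} (hz : 1 < ‖z‖) (S : Finset ℂ) :
    ∃ n₀ : ℕ, ∀ n ≥ n₀, ∀ k : ℕ, ∀ c : Fin k → ℂ, (∀ l, c l ∈ S) →
      ∑ l : Fin k, z ^ (n * (l : ℕ)) * c l = 0 → ∀ l, c l = 0 := by
  obtain ⟨C, hC⟩ : ∃ C : ℝ, ∀ s ∈ S, ‖s‖ ≤ C :=
    ⟨∑ s ∈ S, ‖s‖, fun s hs => Finset.single_le_sum (f := fun s => ‖s‖)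
      (fun _ _ => norm_nonneg _) hs⟩
  obtain ⟨δ, hδ, hSδ⟩ : ∃ δ : ℝ, 0 < δ ∧ ∀ s ∈ S, s ≠ 0 → δ ≤ ‖s‖ := by
    induction S using Finset.induction_on with
    | empty => exact ⟨1, one_pos, by simp⟩
    | insert a S _ ih =>
      obtain ⟨δ, hδ, h⟩ := ih fun s hs => hC s (Finset.mem_insert_of_mem hs)
      by_cases ha : a = 0
      · exact ⟨δ, hδ, fun s hs hs0 =>
          h s ((Finset.mem_insert.1 hs).resolve_left fun e => hs0 (e.trans ha)) hs0⟩
      · refine ⟨min δ ‖a‖, lt_min hδ (norm_pos_iff.2 ha), fun s hs hs0 => ?_⟩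
        rcases Finset.mem_insert.1 hs with rfl | hs
        · exact min_le_right _ _
        · exact (min_le_left _ _).trans (h s hs hs0)
  obtain ⟨n₀, hn₀⟩ := pow_unbounded_of_one_lt (1 + max C 0 / δ) hz
  refine ⟨n₀, fun n hn k c hc hsum => ?_⟩
  refine eq_zero_of_sum_pow_mul_eq_zero hδ (le_max_right C 0) (μ := z ^ n) ?_ k c
    (fun l => (hC _ (hc l)).trans (le_max_left _ _)) (fun l => hSδ _ (hc l))
    (by simpa only [pow_mul] using hsum)
  rw [norm_pow]
  exact hn₀.trans_le (pow_le_pow_right₀ hz.le hn)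

theorem LinearMap.finrank_ker_lt {M V : Type*} [AddCommGroup M] [Module.Finite ℤ M]
    [AddCommGroup V] [Module.IsTorsionFree ℤ V] (φ : M →ₗ[ℤ] V) (hφ : φ ≠ 0) :
    Module.finrank ℤ (LinearMap.ker φ) < Module.finrank ℤ M := by
  rw [← (LinearMap.ker φ).finrank_quotient_add_finrank, φ.quotKerEquivRange.finrank_eq]
  refine Nat.lt_add_of_pos_left (Nat.pos_of_ne_zero fun h => hφ ?_)
  rw [← LinearMap.range_eq_bot]
  exact Submodule.subsingleton_iff_eq_bot.1 ((Module.finrank_eq_zero_iff_of_free ℤ _).1 h)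

theorem LinearMap.exists_forall_eq_zero_of_aperiodic {M : Type*} [AddCommGroup M]
    [Module.Free ℤ M] [Module.Finite ℤ M] (f : M →ₗ[ℤ] M) (hinj : Function.Injective f)
    (haper : ∀ m : ℕ, 1 ≤ m → ∀ y : M, (f ^ m) y = y → y = 0) (Y : Finset M) :
    ∃ n₀ : ℕ, ∀ n ≥ n₀, ∀ k : ℕ, ∀ y : Fin k → M, (∀ l, y l ∈ Y) →
      (∑ l : Fin k, (f ^ (n * (l : ℕ))) (y l)) = 0 → ∀ l, y l = 0 := by
  classical
  induction hr : Module.finrank ℤ M using Nat.strong_induction_on generalizing M with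
  | _ r ih =>
  rcases subsingleton_or_nontrivial M with hM | hM
  · exact ⟨0, fun _ _ _ _ _ _ _ => Subsingleton.elim _ _⟩
  obtain ⟨z, hz, φ, hφ, hφf⟩ := f.exists_eigenfunctional_of_aperiodic hinj haper
  have hφpow : ∀ (j : ℕ) (x : M), φ ((f ^ j) x) = z ^ j * φ x := by
    intro j x
    induction j with
    | zero => simp
    | succ j ih => rw [pow_succ', Module.End.mul_apply, hφf, ih, pow_succ', mul_assoc]
  have hker : ∀ x ∈ LinearMap.ker φ, f x ∈ LinearMap.ker φ := by
    intro x hx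
    rw [LinearMap.mem_ker] at hx ⊢
    rw [hφf, hx, mul_zero]
  let g := f.restrict hker
  have hgpow : ∀ (j : ℕ) (x : LinearMap.ker φ),
      (((g ^ j) x : LinearMap.ker φ) : M) = (f ^ j) x := by
    intro j x
    induction j with
    | zero => simp
    | succ j ih =>
      rw [pow_succ', pow_succ', Module.End.mul_apply, Module.End.mul_apply, ← ih]
      rfl
  obtain ⟨n₁, hn₁⟩ := exists_forall_eq_zero_of_sum_pow_mul_eq_zero hz (Y.image φ)
  obtain ⟨n₂, hn₂⟩ := ih _ (hr ▸ φ.finrank_ker_lt hφ) g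
    (fun x y h => Subtype.ext (hinj (congrArg Subtype.val h)))
    (fun m hm y hy => Subtype.ext (haper m hm y (by rw [← hgpow, hy])))
    (Y.preimage Subtype.val Subtype.val_injective.injOn) rfl
  refine ⟨max n₁ n₂, fun n hn k y hy hsum => ?_⟩
  have hyker : ∀ l, φ (y l) = 0 := by
    refine hn₁ n (le_of_max_le_left hn) k (fun l => φ (y l))
      (fun l => Finset.mem_image_of_mem φ (hy l)) ?_
    simpa [hφpow] using congrArg φ hsum
  have := hn₂ n (le_of_max_le_right hn) k (fun l => ⟨y l, hyker l⟩)
    (fun l => Finset.mem_preimage.2 (hy l))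
    (Subtype.ext (by simpa [hgpow] using hsum))
  exact fun l => congrArg Subtype.val (this l)

/-- Let `d ≥ 1` and let `T : ℤ^d → ℤ^d` be an injective group endomorphism
which is aperiodic. Let `Y` be a finite subset of `ℤ^d` with `0 ∈ Y`. Then there exists
`n₀ ∈ ℕ` such that whenever `∑_{l=1}^{k} T^{n(l-1)} y_l = 0` for `y_1, …, y_k ∈ Y`,
`n ≥ n₀`, `k ∈ ℕ`, we have `y_1 = … = y_k = 0`. -/
theorem statement1 (d : ℕ) (hd : 1 ≤ d) (T : AddMonoid.End (Fin d → ℤ))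
    (hinj : Function.Injective T)
    (haper : ∀ m : ℕ, 1 ≤ m → ∀ y : Fin d → ℤ, (T ^ m) y = y → y = 0)
    (Y : Finset (Fin d → ℤ)) (hY : (0 : Fin d → ℤ) ∈ Y) :
    ∃ n₀ : ℕ, ∀ n ≥ n₀, ∀ k : ℕ, ∀ y : Fin k → (Fin d → ℤ), (∀ l, y l ∈ Y) →
      (∑ l : Fin k, (T ^ (n * (l : ℕ))) (y l)) = 0 → ∀ l, y l = 0 := by
  have hpow : ∀ (j : ℕ) (x : Fin d → ℤ), (T.toIntLinearMap ^ j) x = (T ^ j) x := by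
    intro j x
    induction j with
    | zero => rfl
    | succ j ih =>
      rw [pow_succ', pow_succ', Module.End.mul_apply, ih]
      rfl
  obtain ⟨n₀, h⟩ := LinearMap.exists_forall_eq_zero_of_aperiodic T.toIntLinearMap hinj
    (fun m hm y hy => haper m hm y (by rwa [hpow] at hy)) Y
  exact ⟨n₀, fun n hn k y hy hsum => h n hn k y hy (by simpa only [hpow] using hsum)⟩
end
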